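/- arXiv:2406.18307 — 2 statements merged into one kernel-verified Lean document; each statement's English description precedes it below -/
import Mathlib

section
/- Let α, β ∈ 𝔽_{q^m} with α ≠ 0 and β ≠ 0, let λ ∈ 𝔽_q with λ ≠ 0, and set Ω_λ(α,β) = #{(a,b) ∈ 𝔽_{q^m} × 𝔽_{q^m} : Tr(a²) = 0, Tr(b²) = 0 and Tr(αb + βa) = λ}. Then, as identities of complex numbers: Ω_λ(α,β) = q^{2m−3} + 2(q−1)q^{m−3}·G if m is even, Tr(α²) = 0 and Tr(β²) = 0; Ω_λ(α,β) = q^{2m−3} + 2(q−1)q^{m−3}·G + (q−1)q^{−2}·G² if m is even and exactly one of Tr(α²), Tr(β²) is 0; Ω_λ(α,β) = q^{2m−3} + 2(q−1)q^{m−3}·G + (q−2)q^{−2}·G² if m is even, Tr(α²) ≠ 0 and Tr(β²) ≠ 0; Ω_λ(α,β) = q^{2m−3} − q^{−3}·η̄(Tr(α²)·Tr(β²))·G²·Ḡ² if m is odd, Tr(α²) ≠ 0 and Tr(β²) ≠ 0; and Ω_λ(α,β) = q^{2m−3} if m is odd and (Tr(α²) = 0 or Tr(β²) = 0). -/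
open Finset

/-- The additive character `s ↦ exp(2πi·s̃/q)` of `ZMod q`. -/
noncomputable def zetaQ (q : ℕ) (s : ZMod q) : ℂ :=
  Complex.exp (2 * Real.pi * Complex.I * (s.val : ℂ) / (q : ℂ))

/-- The quadratic Gauss sum `G` over the big field `F`. -/
noncomputable def gaussBig (q : ℕ) [Fact q.Prime] (F : Type*) [Field F] [Fintype F]
    [DecidableEq F] [Algebra (ZMod q) F] : ℂ :=
  ∑ x ∈ Finset.univ.filter (fun x : F => x ≠ 0),
    (quadraticChar F x : ℂ) * zetaQ q (Algebra.trace (ZMod q) F x)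

/-- The quadratic Gauss sum `Ḡ` over the prime field `ZMod q`. -/
noncomputable def gaussSmall (q : ℕ) [Fact q.Prime] : ℂ :=
  ∑ y ∈ Finset.univ.filter (fun y : ZMod q => y ≠ 0),
    (quadraticChar (ZMod q) y : ℂ) * zetaQ q y

/-- `Ω_λ(α,β) = #{(a,b) : Tr(a²) = 0, Tr(b²) = 0 and Tr(αb + βa) = λ}`. -/
noncomputable def Omega (q : ℕ) (F : Type*) [Field F] [Fintype F] [Algebra (ZMod q) F]
    (α β : F) (lam : ZMod q) : ℕ :=
  Nat.card {p : F × F // Algebra.trace (ZMod q) F (p.1 ^ 2) = 0 ∧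
    Algebra.trace (ZMod q) F (p.2 ^ 2) = 0 ∧
    Algebra.trace (ZMod q) F (α * p.2 + β * p.1) = lam}

/-- The quadratic Gauss sum of an additive character of a finite field. -/
noncomputable def quadraticGaussSum {K : Type*} [Field K] [Fintype K] [DecidableEq K]
    (φ : AddChar K ℂ) : ℂ :=
  ∑ x : K, (quadraticChar K x : ℂ) * φ x

section FiniteField

variable {K : Type*} [Field K] [Fintype K] [DecidableEq K]

theorem sum_quadraticChar_mul_addChar (hK : ringChar K ≠ 2) (φ : AddChar K ℂ) (a : K) :
    ∑ x : K, (quadraticChar K x : ℂ) * φ (a * x) =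
      (quadraticChar K a : ℂ) * quadraticGaussSum φ := by
  rcases eq_or_ne a 0 with rfl | ha
  · have h := congrArg (Int.cast (R := ℂ)) (quadraticChar_sum_zero hK)
    push_cast at h
    simpa using h
  · rw [quadraticGaussSum, Finset.mul_sum, ← Equiv.sum_comp (Equiv.mulLeft₀ a ha)
      (fun y => (quadraticChar K a : ℂ) * ((quadraticChar K y : ℂ) * φ y))]
    refine Finset.sum_congr rfl fun x _ => ?_
    have h : (quadraticChar K a : ℂ) ^ 2 = 1 := by
      exact_mod_cast quadraticChar_sq_one ha
    simp only [Equiv.mulLeft₀_apply, map_mul, Int.cast_mul]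
    linear_combination (-(quadraticChar K x : ℂ) * φ (a * x)) * h

theorem sum_addChar_mul_sq (hK : ringChar K ≠ 2) {φ : AddChar K ℂ} (hφ : φ.IsPrimitive)
    {x : K} (hx : x ≠ 0) :
    ∑ a : K, φ (x * a ^ 2) = (quadraticChar K x : ℂ) * quadraticGaussSum φ := by
  have hfib : ∀ t : K, ∑ a : K with a ^ 2 = t, φ (x * a ^ 2) =
      ((quadraticChar K t : ℂ) + 1) * φ (x * t) := by
    intro t
    have hc := congrArg (Int.cast (R := ℂ)) (quadraticChar_card_sqrts hK t)
    push_cast at hc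
    rw [← hc, Finset.sum_congr rfl (g := fun _ => φ (x * t))
      fun a ha => by rw [(Finset.mem_filter.mp ha).2], Finset.sum_const, nsmul_eq_mul]
    congr 3
    ext a
    simp
  rw [← Finset.sum_fiberwise Finset.univ (fun a : K => a ^ 2), Finset.sum_congr rfl
    fun t _ => hfib t]
  simp only [add_mul, one_mul, Finset.sum_add_distrib]
  rw [sum_quadraticChar_mul_addChar hK]
  have h := AddChar.sum_mulShift x hφ
  rw [if_neg hx] at h
  simp only [mul_comm x]
  simp [h]

theorem sum_addChar_quadratic (hK : ringChar K ≠ 2) {φ : AddChar K ℂ} (hφ : φ.IsPrimitive)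
    {x : K} (hx : x ≠ 0) (c : K) :
    ∑ a : K, φ (x * a ^ 2 + c * a) =
      φ (-(c ^ 2 / (4 * x))) * ((quadraticChar K x : ℂ) * quadraticGaussSum φ) := by
  have h2 : (2 : K) ≠ 0 := Ring.two_ne_zero hK
  have h4 : (4 : K) ≠ 0 := by
    rw [show (4 : K) = 2 * 2 by norm_num]
    exact mul_ne_zero h2 h2
  rw [← sum_addChar_mul_sq hK hφ hx, Finset.mul_sum,
    ← Equiv.sum_comp (Equiv.addRight (c / (2 * x)))
      (fun a => φ (-(c ^ 2 / (4 * x))) * φ (x * a ^ 2))]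
  refine Finset.sum_congr rfl fun a _ => ?_
  rw [← AddChar.map_add_eq_mul]
  congr 1
  simp only [Equiv.coe_addRight]
  field_simp
  ring

end FiniteField

section PrimeField

variable {q : ℕ} [Fact q.Prime]

theorem zetaQ_eq_stdAddChar (s : ZMod q) : zetaQ q s = ZMod.stdAddChar s := by
  rw [ZMod.stdAddChar_apply, ZMod.toCircle_apply, zetaQ]

theorem gaussSmall_eq : gaussSmall q = quadraticGaussSum (ZMod.stdAddChar (N := q)) := by
  rw [gaussSmall, quadraticGaussSum, Finset.sum_filter]
  refine Finset.sum_congr rfl fun x _ => ?_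
  split_ifs with h
  · rw [zetaQ_eq_stdAddChar]
  · simp [not_not.mp h]

theorem sum_stdAddChar_mul (t : ZMod q) :
    ∑ s : ZMod q, ZMod.stdAddChar (s * t) = if t = 0 then (q : ℂ) else 0 := by
  rw [AddChar.sum_mulShift t (ZMod.isPrimitive_stdAddChar q), ZMod.card]
  split_ifs <;> simp

end PrimeField

section Extension

variable {q : ℕ} [Fact q.Prime] {F : Type*} [Field F] [Algebra (ZMod q) F]

variable (q F) in
/-- The additive character `x ↦ exp(2πi·Tr(x)/q)`. -/
noncomputable def traceAddChar : AddChar F ℂ :=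
  (ZMod.stdAddChar (N := q)).compAddMonoidHom (Algebra.trace (ZMod q) F).toAddMonoidHom

theorem traceAddChar_apply (x : F) :
    traceAddChar q F x = ZMod.stdAddChar (Algebra.trace (ZMod q) F x) := rfl

theorem traceAddChar_algebraMap_mul (x : ZMod q) (a : F) :
    traceAddChar q F (algebraMap (ZMod q) F x * a) =
      ZMod.stdAddChar (x * Algebra.trace (ZMod q) F a) := by
  rw [traceAddChar_apply, ← Algebra.smul_def, map_smul, smul_eq_mul]

theorem ringChar_eq_of_algebra : ringChar F = q := by
  have := charP_of_injective_algebraMap (algebraMap (ZMod q) F).injective q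
  exact ringChar.eq F q

variable [Fintype F]

theorem isPrimitive_traceAddChar : (traceAddChar q F).IsPrimitive := by
  refine AddChar.IsPrimitive.of_ne_one fun h => ?_
  obtain ⟨x, hx⟩ := Algebra.trace_surjective (ZMod q) F 1
  have h1 := DFunLike.congr_fun h x
  rw [traceAddChar_apply, hx, AddChar.one_apply, ← AddChar.map_zero_eq_one
    (ZMod.stdAddChar (N := q))] at h1
  exact one_ne_zero (ZMod.injective_stdAddChar h1)

variable (q) in
/-- The exponential sum `∑ exp(2πi·Tr(ca)/q)` over the cone `Tr(a²) = 0`. -/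
noncomputable def coneSum (c : F) : ℂ :=
  ∑ a : F with Algebra.trace (ZMod q) F (a ^ 2) = 0, traceAddChar q F (c * a)

theorem coneSum_algebraMap_mul {z : ZMod q} (hz : z ≠ 0) (c : F) :
    coneSum q (algebraMap (ZMod q) F z * c) = coneSum q c := by
  classical
  have hz' : algebraMap (ZMod q) F z ≠ 0 := by simpa using hz
  rw [coneSum, coneSum, Finset.sum_filter, Finset.sum_filter,
    ← Equiv.sum_comp (Equiv.mulLeft₀ (algebraMap (ZMod q) F z) hz')
      (fun a => if Algebra.trace (ZMod q) F (a ^ 2) = 0 then traceAddChar q F (c * a) else 0)]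
  refine Finset.sum_congr rfl fun a _ => ?_
  simp only [Equiv.mulLeft₀_apply]
  rw [mul_pow, ← map_pow, ← Algebra.smul_def (z ^ 2), map_smul, smul_eq_mul,
    show c * (algebraMap (ZMod q) F z * a) = algebraMap (ZMod q) F z * c * a by ring]
  simp [hz]

theorem q_mul_Omega (α β : F) {lam : ZMod q} (hlam : lam ≠ 0) :
    q * (Omega q F α β lam : ℂ) = coneSum q (0 : F) ^ 2 - coneSum q α * coneSum q β := by
  classical
  set Q : Finset F := {a : F | Algebra.trace (ZMod q) F (a ^ 2) = 0} with hQ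
  have hOmega : (Omega q F α β lam : ℂ) = ∑ a ∈ Q, ∑ b ∈ Q,
      if Algebra.trace (ZMod q) F (α * b + β * a) - lam = 0 then (1 : ℂ) else 0 := by
    rw [← Finset.sum_product', Finset.sum_boole, Omega, Nat.card_eq_fintype_card,
      Fintype.card_subtype]
    congr 2
    ext p
    simp [hQ, sub_eq_zero, and_assoc]
  have hz : ∀ z : ZMod q, ∑ a ∈ Q, ∑ b ∈ Q,
      (ZMod.stdAddChar (z * (Algebra.trace (ZMod q) F (α * b + β * a) - lam)) : ℂ) =
      ZMod.stdAddChar (z * -lam) * (coneSum q (algebraMap (ZMod q) F z * α) *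
        coneSum q (algebraMap (ZMod q) F z * β)) := by
    intro z
    rw [coneSum, coneSum, mul_comm (∑ a ∈ _, _), Finset.sum_mul_sum, Finset.mul_sum]
    refine Finset.sum_congr rfl fun a _ => ?_
    rw [Finset.mul_sum]
    refine Finset.sum_congr rfl fun b _ => ?_
    rw [mul_assoc, mul_assoc, traceAddChar_algebraMap_mul, traceAddChar_algebraMap_mul,
      ← AddChar.map_add_eq_mul, ← AddChar.map_add_eq_mul, map_add]
    congr 1
    ring
  have hsum : q * (Omega q F α β lam : ℂ) = ∑ z : ZMod q, ∑ a ∈ Q, ∑ b ∈ Q,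
      ZMod.stdAddChar (z * (Algebra.trace (ZMod q) F (α * b + β * a) - lam)) := by
    rw [hOmega, Finset.mul_sum, Finset.sum_comm]
    refine Finset.sum_congr rfl fun a _ => ?_
    rw [Finset.mul_sum, Finset.sum_comm]
    refine Finset.sum_congr rfl fun b _ => ?_
    rw [sum_stdAddChar_mul]
    split_ifs <;> simp
  have hterm : ∀ z : ZMod q, ZMod.stdAddChar (z * -lam) *
      (coneSum q (algebraMap (ZMod q) F z * α) * coneSum q (algebraMap (ZMod q) F z * β)) =
      ZMod.stdAddChar (z * -lam) * (coneSum q α * coneSum q β) +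
        if z = 0 then coneSum q (0 : F) ^ 2 - coneSum q α * coneSum q β else 0 := by
    intro z
    rcases eq_or_ne z 0 with rfl | h
    · simp
      ring
    · simp [h, coneSum_algebraMap_mul]
  rw [hsum, Finset.sum_congr rfl fun z _ => (hz z).trans (hterm z), Finset.sum_add_distrib,
    ← Finset.sum_mul, sum_stdAddChar_mul]
  simp [hlam]

variable [DecidableEq F]

theorem gaussBig_eq : gaussBig q F = quadraticGaussSum (traceAddChar q F) := by
  rw [gaussBig, quadraticGaussSum, Finset.sum_filter]
  refine Finset.sum_congr rfl fun x _ => ?_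
  split_ifs with h
  · rw [zetaQ_eq_stdAddChar, traceAddChar_apply]
  · simp [not_not.mp h]

theorem quadraticChar_algebraMap (hq : q ≠ 2) {m : ℕ} (hF : Fintype.card F = q ^ m)
    (x : ZMod q) (hx : x ≠ 0) :
    quadraticChar F (algebraMap (ZMod q) F x) = quadraticChar (ZMod q) x ^ m := by
  have hF2 : ringChar F ≠ 2 := by rwa [ringChar_eq_of_algebra (q := q)]
  have hq2 : ringChar (ZMod q) ≠ 2 := by rwa [ZMod.ringChar_zmod_n]
  have hodd : Odd q := (Fact.out : q.Prime).odd_of_ne_two hq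
  have hexp : q ^ m / 2 = q / 2 * ∑ i ∈ Finset.range m, q ^ i := by
    have h1 := Nat.geomSum_eq (Fact.out : q.Prime).two_le m
    have h2 : (q - 1) * ∑ i ∈ Finset.range m, q ^ i = q ^ m - 1 := by
      rw [h1, Nat.mul_div_cancel' (by simpa using Nat.sub_dvd_pow_sub_pow q 1 m)]
    obtain ⟨k, hk⟩ := hodd
    have hk2 : q / 2 = k := by omega
    have hk1 : q - 1 = 2 * k := by omega
    rw [hk2]
    rw [hk1, mul_assoc] at h2
    have : Odd (q ^ m) := Odd.pow ⟨k, hk⟩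
    obtain ⟨j, hj⟩ := this
    omega
  have hpow : ∀ (u : ZMod q) (n : ℕ), u ^ (∑ i ∈ Finset.range n, q ^ i) = u ^ n := by
    intro u n
    rw [← Finset.prod_pow_eq_pow_sum, Finset.prod_congr rfl fun i _ => ZMod.pow_card_pow u]
    simp
  have hcast : ((quadraticChar F (algebraMap (ZMod q) F x) : ℤ) : F) =
      ((quadraticChar (ZMod q) x ^ m : ℤ) : F) := by
    rw [quadraticChar_eq_pow_of_char_ne_two' hF2, hF, hexp, ← map_pow, pow_mul, hpow,
      ← map_intCast (algebraMap (ZMod q) F), Int.cast_pow,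
      quadraticChar_eq_pow_of_char_ne_two' hq2, ZMod.card]
  have hx' : algebraMap (ZMod q) F x ≠ 0 := by simpa using hx
  refine Int.cast_injOn_of_ringChar_ne_two hF2 ?_ ?_ hcast
  · rcases quadraticChar_dichotomy hx' with h | h <;> simp [h]
  · rcases quadraticChar_dichotomy hx with h | h
    · simp [h]
    · rcases neg_one_pow_eq_or ℤ m with h' | h' <;> simp [h, h']

theorem sum_traceAddChar_mul {m : ℕ} (hF : Fintype.card F = q ^ m) (c : F) :
    ∑ a : F, traceAddChar q F (c * a) = if c = 0 then (q : ℂ) ^ m else 0 := by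
  have h := AddChar.sum_mulShift c (isPrimitive_traceAddChar (q := q) (F := F))
  simp only [mul_comm c]
  rw [h, hF]
  split_ifs <;> simp

/-- The sum of the `m`-th power of the quadratic character of `ZMod q`, twisted by the additive
character of frequency `s`. -/
noncomputable def twistedPowSum (q m : ℕ) [Fact q.Prime] (s : ZMod q) : ℂ :=
  ∑ x : ZMod q, (quadraticChar (ZMod q) x : ℂ) ^ m * ZMod.stdAddChar (s * x)

theorem twistedPowSum_of_odd (hq : q ≠ 2) {m : ℕ} (hm : Odd m) (s : ZMod q) :
    twistedPowSum q m s = (quadraticChar (ZMod q) s : ℂ) * gaussSmall q := by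
  have hq2 : ringChar (ZMod q) ≠ 2 := by rwa [ZMod.ringChar_zmod_n]
  rw [gaussSmall_eq, ← sum_quadraticChar_mul_addChar hq2, twistedPowSum]
  refine Finset.sum_congr rfl fun x _ => ?_
  congr 1
  rcases eq_or_ne x 0 with rfl | hx
  · simp [hm.pos.ne']
  · rcases quadraticChar_dichotomy hx with h | h <;> simp [h, hm.neg_one_pow]

theorem twistedPowSum_of_even {m : ℕ} (hm : Even m) (hm0 : m ≠ 0) (s : ZMod q) :
    twistedPowSum q m s = (if s = 0 then (q : ℂ) else 0) - 1 := by
  have h1 : ∀ x : ZMod q, (quadraticChar (ZMod q) x : ℂ) ^ m * ZMod.stdAddChar (s * x) =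
      ZMod.stdAddChar (x * s) - if x = 0 then 1 else 0 := by
    intro x
    rcases eq_or_ne x 0 with rfl | hx
    · simp [hm0]
    · rcases quadraticChar_dichotomy hx with h | h <;> simp [h, hm.neg_one_pow, hx, mul_comm s]
  rw [twistedPowSum, Finset.sum_congr rfl fun x _ => h1 x, Finset.sum_sub_distrib,
    sum_stdAddChar_mul]
  simp

theorem q_mul_coneSum (hq : q ≠ 2) {m : ℕ} (hm : m ≠ 0) (hF : Fintype.card F = q ^ m) (c : F) :
    q * coneSum q c = (if c = 0 then (q : ℂ) ^ m else 0) +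
      gaussBig q F * twistedPowSum q m (-(Algebra.trace (ZMod q) F (c ^ 2) / 4)) := by
  have hF2 : ringChar F ≠ 2 := by rwa [ringChar_eq_of_algebra (q := q)]
  have hinner : ∀ x : ZMod q,
      ∑ a : F, traceAddChar q F (algebraMap (ZMod q) F x * a ^ 2 + c * a) =
        (if x = 0 then if c = 0 then (q : ℂ) ^ m else 0 else 0) +
        gaussBig q F * ((quadraticChar (ZMod q) x⁻¹ : ℂ) ^ m *
          ZMod.stdAddChar (-(Algebra.trace (ZMod q) F (c ^ 2) / 4) * x⁻¹)) := by
    intro x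
    rcases eq_or_ne x 0 with rfl | hx
    · simp [sum_traceAddChar_mul hF, hm]
    · have hx' : algebraMap (ZMod q) F x ≠ 0 := by simpa using hx
      have harg : -(c ^ 2 / (4 * algebraMap (ZMod q) F x)) =
          algebraMap (ZMod q) F (-(4 * x)⁻¹) * c ^ 2 := by
        simp only [map_neg, map_inv₀, map_mul, map_ofNat]
        ring
      have hinv : quadraticChar (ZMod q) x⁻¹ = quadraticChar (ZMod q) x := by
        have h1 := quadraticChar_sq_one hx
        have h2 : quadraticChar (ZMod q) x * quadraticChar (ZMod q) x⁻¹ = 1 := by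
          rw [← map_mul, mul_inv_cancel₀ hx, map_one]
        linear_combination quadraticChar (ZMod q) x * h2 - quadraticChar (ZMod q) x⁻¹ * h1
      rw [sum_addChar_quadratic hF2 isPrimitive_traceAddChar hx', if_neg hx, ← gaussBig_eq, harg,
        traceAddChar_algebraMap_mul, quadraticChar_algebraMap hq hF x hx, hinv,
        show -(4 * x)⁻¹ * Algebra.trace (ZMod q) F (c ^ 2) =
          -(Algebra.trace (ZMod q) F (c ^ 2) / 4) * x⁻¹ by rw [mul_inv]; ring]
      push_cast
      ring
  have hcone : q * coneSum q c = ∑ x : ZMod q,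
      ∑ a : F, traceAddChar q F (algebraMap (ZMod q) F x * a ^ 2 + c * a) := by
    rw [Finset.sum_comm, coneSum, Finset.sum_filter, Finset.mul_sum]
    refine Finset.sum_congr rfl fun a _ => ?_
    simp only [AddChar.map_add_eq_mul, traceAddChar_algebraMap_mul]
    rw [← Finset.sum_mul, sum_stdAddChar_mul]
    split_ifs <;> simp
  rw [hcone, Finset.sum_congr rfl fun x _ => hinner x, Finset.sum_add_distrib, ← Finset.mul_sum,
    twistedPowSum, ← Equiv.sum_comp (Equiv.inv (ZMod q)) (fun x =>
      (quadraticChar (ZMod q) x : ℂ) ^ m *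
        ZMod.stdAddChar (-(Algebra.trace (ZMod q) F (c ^ 2) / 4) * x))]
  simp

end Extension

theorem Omega_eq {q : ℕ} [Fact q.Prime] (hq : q ≠ 2) {m : ℕ} (hm : m ≠ 0) {F : Type*} [Field F]
    [Fintype F] [DecidableEq F] [Algebra (ZMod q) F] (hF : Fintype.card F = q ^ m) {α β : F}
    (hα : α ≠ 0) (hβ : β ≠ 0) {lam : ZMod q} (hlam : lam ≠ 0) :
    (q : ℂ) ^ 3 * (Omega q F α β lam : ℂ) =
      ((q : ℂ) ^ m + gaussBig q F * twistedPowSum q m 0) ^ 2 -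
      gaussBig q F ^ 2 * (twistedPowSum q m (-(Algebra.trace (ZMod q) F (α ^ 2) / 4)) *
        twistedPowSum q m (-(Algebra.trace (ZMod q) F (β ^ 2) / 4))) := by
  have h0 := q_mul_coneSum hq hm hF (0 : F)
  have h1 := q_mul_coneSum hq hm hF α
  have h2 := q_mul_coneSum hq hm hF β
  rw [if_neg hα, zero_add] at h1
  rw [if_neg hβ, zero_add] at h2
  simp only [if_true, ne_eq, OfNat.ofNat_ne_zero, not_false_eq_true, zero_pow, map_zero, zero_div,
    neg_zero] at h0
  have h := q_mul_Omega α β hlam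
  rw [← h0, mul_pow, show ∀ a b c : ℂ, a ^ 2 * (b * c) = (a * b) * (a * c) by intros; ring,
    ← h1, ← h2]
  linear_combination (q : ℂ) ^ 2 * h

theorem stmt7 (q m : ℕ) [Fact q.Prime] (hq : Odd q) (hm : 2 ≤ m)
    (F : Type*) [Field F] [Fintype F] [DecidableEq F] [Algebra (ZMod q) F]
    (hF : Fintype.card F = q ^ m) (α β : F) (hα : α ≠ 0) (hβ : β ≠ 0)
    (lam : ZMod q) (hlam : lam ≠ 0) :
    (Even m → Algebra.trace (ZMod q) F (α ^ 2) = 0 → Algebra.trace (ZMod q) F (β ^ 2) = 0 →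
      (Omega q F α β lam : ℂ) = (q : ℂ) ^ (2 * (m : ℤ) - 3) +
        2 * ((q : ℂ) - 1) * (q : ℂ) ^ ((m : ℤ) - 3) * gaussBig q F) ∧
    (Even m →
      ((Algebra.trace (ZMod q) F (α ^ 2) = 0 ∧ Algebra.trace (ZMod q) F (β ^ 2) ≠ 0) ∨
       (Algebra.trace (ZMod q) F (α ^ 2) ≠ 0 ∧ Algebra.trace (ZMod q) F (β ^ 2) = 0)) →
      (Omega q F α β lam : ℂ) = (q : ℂ) ^ (2 * (m : ℤ) - 3) +
        2 * ((q : ℂ) - 1) * (q : ℂ) ^ ((m : ℤ) - 3) * gaussBig q F +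
        ((q : ℂ) - 1) * (q : ℂ) ^ (-2 : ℤ) * (gaussBig q F) ^ 2) ∧
    (Even m → Algebra.trace (ZMod q) F (α ^ 2) ≠ 0 → Algebra.trace (ZMod q) F (β ^ 2) ≠ 0 →
      (Omega q F α β lam : ℂ) = (q : ℂ) ^ (2 * (m : ℤ) - 3) +
        2 * ((q : ℂ) - 1) * (q : ℂ) ^ ((m : ℤ) - 3) * gaussBig q F +
        ((q : ℂ) - 2) * (q : ℂ) ^ (-2 : ℤ) * (gaussBig q F) ^ 2) ∧
    (Odd m → Algebra.trace (ZMod q) F (α ^ 2) ≠ 0 → Algebra.trace (ZMod q) F (β ^ 2) ≠ 0 →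
      (Omega q F α β lam : ℂ) = (q : ℂ) ^ (2 * (m : ℤ) - 3) -
        (q : ℂ) ^ (-3 : ℤ) *
          (quadraticChar (ZMod q)
            (Algebra.trace (ZMod q) F (α ^ 2) * Algebra.trace (ZMod q) F (β ^ 2)) : ℂ) *
          (gaussBig q F) ^ 2 * (gaussSmall q) ^ 2) ∧
    (Odd m →
      (Algebra.trace (ZMod q) F (α ^ 2) = 0 ∨ Algebra.trace (ZMod q) F (β ^ 2) = 0) →
      (Omega q F α β lam : ℂ) = (q : ℂ) ^ (2 * (m : ℤ) - 3)) := by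
  have hq2 : q ≠ 2 := by
    rintro rfl
    exact absurd hq (by decide)
  have hm0 : m ≠ 0 := by omega
  have hqC : (q : ℂ) ≠ 0 := Nat.cast_ne_zero.mpr (Fact.out : q.Prime).ne_zero
  have h2 : (2 : ZMod q) ≠ 0 := Ring.two_ne_zero (by rwa [ZMod.ringChar_zmod_n])
  have h4' : (4 : ZMod q) = 2 ^ 2 := by norm_num
  have h4 : (4 : ZMod q) ≠ 0 := h4' ▸ pow_ne_zero 2 h2
  have hmain := Omega_eq hq2 hm0 hF hα hβ hlam
  have e1 : (q : ℂ) ^ (2 * (m : ℤ) - 3) = ((q : ℂ) ^ m) ^ 2 / (q : ℂ) ^ 3 := by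
    rw [zpow_sub₀ hqC, mul_comm 2, zpow_mul]
    norm_cast
  have e2 : (q : ℂ) ^ ((m : ℤ) - 3) = (q : ℂ) ^ m / (q : ℂ) ^ 3 := by
    rw [zpow_sub₀ hqC]
    norm_cast
  have e3 : (q : ℂ) ^ (-2 : ℤ) = q / (q : ℂ) ^ 3 := by
    rw [zpow_neg]
    field_simp
  have e4 : (q : ℂ) ^ (-3 : ℤ) = 1 / (q : ℂ) ^ 3 := by
    rw [zpow_neg, one_div]
    norm_cast
  have hΩ := eq_div_of_mul_eq (pow_ne_zero 3 hqC) ((mul_comm _ _).trans hmain)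
  rw [e1, e2, e3, e4, hΩ]
  have heven : ∀ t : ZMod q, Even m → twistedPowSum q m (-(t / 4)) =
      (if t = 0 then (q : ℂ) else 0) - 1 := by
    intro t hm
    rw [twistedPowSum_of_even hm hm0]
    simp [h4]
  have heven0 : Even m → twistedPowSum q m 0 = (q : ℂ) - 1 := by
    intro hm
    rw [twistedPowSum_of_even hm hm0, if_pos rfl]
  have hodd0 : Odd m → twistedPowSum q m 0 = 0 := by
    intro hm
    simp [twistedPowSum_of_odd hq2 hm]
  have hodd : ∀ s t : ZMod q, Odd m →
      twistedPowSum q m (-(s / 4)) * twistedPowSum q m (-(t / 4)) =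
      (quadraticChar (ZMod q) (s * t) : ℂ) * gaussSmall q ^ 2 := by
    intro s t hm
    have h : quadraticChar (ZMod q) (-(s / 4)) * quadraticChar (ZMod q) (-(t / 4)) =
        quadraticChar (ZMod q) (s * t) := by
      rw [← map_mul, show -(s / 4) * -(t / 4) = s * t * (4⁻¹) ^ 2 by ring, map_mul,
        quadraticChar_sq_one' (inv_ne_zero h4), mul_one]
    rw [twistedPowSum_of_odd hq2 hm, twistedPowSum_of_odd hq2 hm, ← h]
    push_cast
    ring
  refine ⟨fun hm ha hb => ?_, fun hm hab => ?_, fun hm ha hb => ?_, fun hm ha hb => ?_,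
    fun hm hab => ?_⟩
  · rw [heven _ hm, heven _ hm, heven0 hm, if_pos ha, if_pos hb]
    field_simp
    ring
  · rcases hab with ⟨ha, hb⟩ | ⟨ha, hb⟩
    · rw [heven _ hm, heven _ hm, heven0 hm, if_pos ha, if_neg hb]
      field_simp
      ring
    · rw [heven _ hm, heven _ hm, heven0 hm, if_neg ha, if_pos hb]
      field_simp
      ring
  · rw [heven _ hm, heven _ hm, heven0 hm, if_neg ha, if_neg hb]
    field_simp
    ring
  · rw [hodd _ _ hm, hodd0 hm]
    field_simp
    ring
  · have h : Algebra.trace (ZMod q) F (α ^ 2) * Algebra.trace (ZMod q) F (β ^ 2) = 0 :=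
      mul_eq_zero.mpr hab
    rw [hodd _ _ hm, hodd0 hm, h]
    simp
end

section
/- Let m ≥ 3 be odd. Then the number of pairs (α,β) ∈ 𝔽_{q^m} × 𝔽_{q^m} with W(α,β) = 2(q−1)(q^{2m−3} − q^{m−2}) equals ((q−1)²/2)·(q^{2m−2} + q^{m−1}). -/
open Finset

/-- The defining set `D = {(a,b) ≠ (0,0) : Tr(a²) = 0 and Tr(b²) = 0}`. -/
noncomputable def defSet (q : ℕ) (F : Type*) [Field F] [Fintype F] [DecidableEq F]
    [Algebra (ZMod q) F] : Finset (F × F) :=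
  Finset.univ.filter (fun p : F × F => p ≠ (0, 0) ∧
    Algebra.trace (ZMod q) F (p.1 ^ 2) = 0 ∧ Algebra.trace (ZMod q) F (p.2 ^ 2) = 0)

/-- The Lee weight `W(α,β)` of the codeword of `C_D` corresponding to `x = α + uβ`,
i.e. the Hamming weight of its Gray image. -/
noncomputable def leeW (q : ℕ) (F : Type*) [Field F] [Fintype F] [DecidableEq F]
    [Algebra (ZMod q) F] (α β : F) : ℕ :=
  ((defSet q F).filter
      (fun p => Algebra.trace (ZMod q) F (α * p.1 + β * p.2) ≠ 0)).card +
  ((defSet q F).filter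
      (fun p => Algebra.trace (ZMod q) F (β * p.1 + α * p.2) ≠ 0)).card

section QuadraticCharacter

variable (F : Type*) [Field F] [Fintype F] [DecidableEq F]

/-- The quadratic character of a finite field with values in `ℂ`. -/
noncomputable def complexQuadraticChar : MulChar F ℂ :=
  (quadraticChar F).ringHomComp (Int.castRingHom ℂ)

variable {F}

theorem complexQuadraticChar_apply (a : F) :
    complexQuadraticChar F a = (quadraticChar F a : ℂ) := rfl

theorem complexQuadraticChar_ne_one (hF : ringChar F ≠ 2) : complexQuadraticChar F ≠ 1 :=
  (MulChar.ringHomComp_ne_one_iff Int.cast_injective).2 (quadraticChar_ne_one hF)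

theorem complexQuadraticChar_inv (a : F) :
    complexQuadraticChar F a⁻¹ = complexQuadraticChar F a := by
  have h : quadraticChar F a⁻¹ = quadraticChar F a := by
    rw [← MulChar.inv_apply', (quadraticChar_isQuadratic F).inv]
  simp only [complexQuadraticChar_apply, h]

theorem gaussSum_complexQuadraticChar_mulShift (hF : ringChar F ≠ 2) (ψ : AddChar F ℂ) (a : F) :
    gaussSum (complexQuadraticChar F) (ψ.mulShift a) =
      complexQuadraticChar F a * gaussSum (complexQuadraticChar F) ψ := by
  rcases eq_or_ne a 0 with rfl | ha
  · rw [AddChar.mulShift_zero, MulChar.map_zero, zero_mul,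
      gaussSum_one_right (complexQuadraticChar_ne_one hF)]
  · have h := gaussSum_mulShift (complexQuadraticChar F) ψ (Units.mk0 a ha)
    have h1 : complexQuadraticChar F a * complexQuadraticChar F a = 1 := by
      rw [complexQuadraticChar_apply, ← sq]
      exact_mod_cast quadraticChar_sq_one ha
    rw [Units.val_mk0] at h
    rw [← h, ← mul_assoc, h1, one_mul]

theorem gaussSum_complexQuadraticChar_sq (hF : ringChar F ≠ 2) {ψ : AddChar F ℂ}
    (hψ : ψ.IsPrimitive) :
    gaussSum (complexQuadraticChar F) ψ ^ 2 =
      complexQuadraticChar F (-1) * (Fintype.card F : ℂ) :=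
  gaussSum_sq (complexQuadraticChar_ne_one hF) ((quadraticChar_isQuadratic F).comp _) hψ

theorem sum_comp_sq (hF : ringChar F ≠ 2) (f : F → ℂ) :
    ∑ a : F, f (a ^ 2) = ∑ x : F, (complexQuadraticChar F x + 1) * f x := by
  rw [← Finset.sum_fiberwise (s := univ) (g := fun a : F => a ^ 2)]
  refine Finset.sum_congr rfl fun x _ => ?_
  rw [Finset.sum_congr rfl (g := fun _ => f x)
    (fun a ha => by rw [(Finset.mem_filter.1 ha).2]), Finset.sum_const, nsmul_eq_mul]
  congr 1
  have h := quadraticChar_card_sqrts hF x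
  rw [complexQuadraticChar_apply, ← Int.cast_one, ← Int.cast_add, ← h, Int.cast_natCast]
  congr 2
  ext a
  simp

theorem sum_addChar_mul_sq_s11 (hF : ringChar F ≠ 2) {ψ : AddChar F ℂ} (hψ : ψ.IsPrimitive)
    {z : F} (hz : z ≠ 0) :
    ∑ a : F, ψ (z * a ^ 2) =
      complexQuadraticChar F z * gaussSum (complexQuadraticChar F) ψ := by
  rw [sum_comp_sq hF (fun x => ψ (z * x)), ← gaussSum_complexQuadraticChar_mulShift hF]
  simp only [add_mul, one_mul, Finset.sum_add_distrib]
  have h0 := AddChar.sum_mulShift z hψ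
  simp only [hz, if_false, mul_comm _ z, Nat.cast_zero] at h0
  rw [h0, add_zero]
  rfl

theorem sum_addChar_mul_sq_add (hF : ringChar F ≠ 2) {ψ : AddChar F ℂ} (hψ : ψ.IsPrimitive)
    {z : F} (hz : z ≠ 0) (α : F) :
    ∑ a : F, ψ (z * a ^ 2 + α * a) =
      ψ (-(α ^ 2 * (4 * z)⁻¹)) *
        (complexQuadraticChar F z * gaussSum (complexQuadraticChar F) ψ) := by
  have h2 : (2 : F) ≠ 0 := Ring.two_ne_zero hF
  have h4 : (4 : F) ≠ 0 := by
    rw [show (4 : F) = 2 * 2 by norm_num]; exact mul_ne_zero h2 h2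
  rw [← sum_addChar_mul_sq_s11 hF hψ hz, Finset.mul_sum,
    ← Equiv.sum_comp (Equiv.addRight (α * (2 * z)⁻¹)) 
      (fun a => ψ (-(α ^ 2 * (4 * z)⁻¹)) * ψ (z * a ^ 2))]
  refine Finset.sum_congr rfl fun a _ => ?_
  rw [← AddChar.map_add_eq_mul, Equiv.coe_addRight]
  congr 1
  field_simp
  ring

theorem quadraticChar_algebraMap_of_odd {K : Type*} [Field K] [Fintype K] [DecidableEq K]
    [Algebra K F] (hK : ringChar K ≠ 2) {m : ℕ} (hm : Odd m)
    (hF : Fintype.card F = Fintype.card K ^ m) (z : K) :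
    quadraticChar F (algebraMap K F z) = quadraticChar K z := by
  have hF2 : ringChar F ≠ 2 := by
    rwa [← Algebra.ringChar_eq K F]
  rcases eq_or_ne z 0 with rfl | hz
  · simp
  have hodd : Odd (Fintype.card K) :=
    Nat.odd_iff.2 (FiniteField.odd_card_of_char_ne_two hK)
  obtain ⟨r, hr⟩ := hodd
  have hr2 : Fintype.card K / 2 = r := by omega
  have hgeom : Fintype.card F / 2 = r * ∑ i ∈ range m, Fintype.card K ^ i := by
    have h2 : (Fintype.card F : ℤ) = 2 * (r * ∑ i ∈ range m, Fintype.card K ^ i : ℕ) + 1 := by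
      have h3 := mul_geom_sum (Fintype.card K : ℤ) m
      rw [hF]
      push_cast
      have h4 : (Fintype.card K : ℤ) - 1 = 2 * r := by rw [hr]; push_cast; ring
      rw [h4] at h3
      linarith
    omega
  have hsum : Odd (∑ i ∈ range m, Fintype.card K ^ i) := by
    rw [Finset.odd_sum_iff_odd_card_odd, Finset.filter_true_of_mem, Finset.card_range]
    · exact hm
    · intro i _
      exact Odd.pow ⟨r, hr⟩
  rw [quadraticChar_eq_pow_of_char_ne_two hK hz, quadraticChar_eq_pow_of_char_ne_two hF2
    (by simpa using hz), hr2, hgeom, pow_mul, ← map_pow]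
  rcases FiniteField.pow_dichotomy hK hz with h | h
  · rw [hr2] at h; simp [h]
  · rw [hr2] at h
    rw [h, map_neg, map_one, hsum.neg_one_pow]
    simp only [Ring.neg_one_ne_one_of_char_ne_two hF2, Ring.neg_one_ne_one_of_char_ne_two hK]

end QuadraticCharacter

section TraceForm

variable {q m : ℕ} [Fact q.Prime] {F : Type*} [Field F] [Algebra (ZMod q) F]

/-- The additive character of `F` obtained from one of the prime field through the trace. -/
noncomputable def traceChar (F : Type*) [Field F] [Algebra (ZMod q) F]
    (ψ : AddChar (ZMod q) ℂ) : AddChar F ℂ :=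
  ψ.compAddMonoidHom (Algebra.trace (ZMod q) F).toAddMonoidHom

theorem traceChar_apply (ψ : AddChar (ZMod q) ℂ) (a : F) :
    traceChar F ψ a = ψ (Algebra.trace (ZMod q) F a) := rfl

variable [Fintype F]

theorem traceChar_isPrimitive {ψ : AddChar (ZMod q) ℂ} (hψ : ψ.IsPrimitive) :
    (traceChar F ψ).IsPrimitive := by
  refine AddChar.IsPrimitive.of_ne_one fun h => ?_
  obtain ⟨a, ha⟩ := Algebra.trace_surjective (ZMod q) F 1
  have h1 : ψ 1 = 1 := by
    rw [← ha, ← traceChar_apply, h, AddChar.one_apply]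
  exact one_ne_zero ((hψ.zmod_char_eq_one_iff q 1).1 h1)

variable (q) in
/-- The character sum over the isotropic vectors of `a ↦ Tr(a²)`. -/
noncomputable def isotropicSum (ψ : AddChar (ZMod q) ℂ) (α : F) : ℂ :=
  ∑ a : F with Algebra.trace (ZMod q) F (a ^ 2) = 0, ψ (Algebra.trace (ZMod q) F (α * a))

theorem isotropicSum_mul_isotropicSum (ψ : AddChar (ZMod q) ℂ) (α β : F) :
    isotropicSum q ψ α * isotropicSum q ψ β =
      ∑ p ∈ (univ.filter fun a : F => Algebra.trace (ZMod q) F (a ^ 2) = 0) ×ˢ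
        (univ.filter fun a : F => Algebra.trace (ZMod q) F (a ^ 2) = 0),
        ψ (Algebra.trace (ZMod q) F (α * p.1 + β * p.2)) := by
  rw [isotropicSum, isotropicSum, Finset.sum_mul_sum, Finset.sum_product]
  simp only [map_add, AddChar.map_add_eq_mul]

variable [DecidableEq F]

theorem mul_isotropicSum {ψ : AddChar (ZMod q) ℂ} (hψ : ψ.IsPrimitive) (hq : Odd q)
    (hm : Odd m) (hF : Fintype.card F = q ^ m) (α : F) :
    q * isotropicSum q ψ α = (if α = 0 then (q : ℂ) ^ m else 0) +
      complexQuadraticChar (ZMod q) (-1) * gaussSum (complexQuadraticChar F) (traceChar F ψ) *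
        gaussSum (complexQuadraticChar (ZMod q)) ψ *
        complexQuadraticChar (ZMod q) (Algebra.trace (ZMod q) F (α ^ 2)) := by
  have hq2 : ringChar (ZMod q) ≠ 2 := by
    rw [ZMod.ringChar_zmod_n]
    rintro rfl
    exact absurd hq (by decide)
  have hF2 : ringChar F ≠ 2 := by
    rwa [← Algebra.ringChar_eq (ZMod q) F]
  have hΨ := traceChar_isPrimitive (F := F) hψ
  set G := gaussSum (complexQuadraticChar F) (traceChar F ψ)
  set t := Algebra.trace (ZMod q) F (α ^ 2) with ht
  have h2 : (2 : ZMod q) ≠ 0 := Ring.two_ne_zero hq2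
  have h4 : complexQuadraticChar (ZMod q) 4⁻¹ = 1 := by
    rw [complexQuadraticChar_inv, complexQuadraticChar_apply,
      show (4 : ZMod q) = 2 ^ 2 by norm_num, quadraticChar_sq_one' h2, Int.cast_one]
  have key : ∀ z : ZMod q,
      ∑ a : F, ψ (z * Algebra.trace (ZMod q) F (a ^ 2)) * ψ (Algebra.trace (ZMod q) F (α * a)) =
      (if z = 0 then (if α = 0 then (q : ℂ) ^ m else 0) else 0) +
        G * (complexQuadraticChar (ZMod q) z⁻¹ * ψ (-1 * t * 4⁻¹ * z⁻¹)) := by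
    intro z
    split_ifs with hz hα
    · simp [hz, hα, hF, MulChar.map_zero]
    · have h := AddChar.sum_mulShift α hΨ
      simp only [hα, if_false, traceChar_apply, mul_comm _ α, Nat.cast_zero] at h
      simp [hz, h, MulChar.map_zero]
    · have hz' : algebraMap (ZMod q) F z ≠ 0 := by simpa using hz
      have h := sum_addChar_mul_sq_add hF2 hΨ hz' α
      have hc : complexQuadraticChar F (algebraMap (ZMod q) F z) =
          complexQuadraticChar (ZMod q) z⁻¹ := by
        rw [complexQuadraticChar_inv, complexQuadraticChar_apply, complexQuadraticChar_apply,
          quadraticChar_algebraMap_of_odd hq2 hm (by rw [hF, ZMod.card])]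
      have he : -(α ^ 2 * (4 * algebraMap (ZMod q) F z)⁻¹) = (-1 * 4⁻¹ * z⁻¹ : ZMod q) • α ^ 2 := by
        rw [Algebra.smul_def]
        simp only [map_mul, map_neg, map_one, map_inv₀, map_ofNat, mul_inv]
        ring
      rw [hc, he, traceChar_apply, map_smul, ← ht] at h
      rw [zero_add, show -1 * t * 4⁻¹ * z⁻¹ = (-1 * 4⁻¹ * z⁻¹ : ZMod q) • t by
        rw [smul_eq_mul]; ring, ← mul_assoc, mul_comm, mul_comm G, ← h]
      refine Finset.sum_congr rfl fun a _ => ?_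
      rw [AddChar.map_add_eq_mul, traceChar_apply, traceChar_apply, ← Algebra.smul_def, map_smul,
        smul_eq_mul]
  have hexp : q * isotropicSum q ψ α = ∑ z : ZMod q, ∑ a : F,
      ψ (z * Algebra.trace (ZMod q) F (a ^ 2)) * ψ (Algebra.trace (ZMod q) F (α * a)) := by
    rw [Finset.sum_comm, isotropicSum, Finset.sum_filter, Finset.mul_sum]
    refine Finset.sum_congr rfl fun a _ => ?_
    rw [← Finset.sum_mul, AddChar.sum_mulShift _ hψ, ZMod.card]
    split_ifs <;> simp
  rw [hexp, Finset.sum_congr rfl fun z _ => key z, Finset.sum_add_distrib, ← Finset.mul_sum,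
    Finset.sum_ite_eq' univ (0 : ZMod q), if_pos (Finset.mem_univ _)]
  congr 1
  have hsum : ∑ z : ZMod q, complexQuadraticChar (ZMod q) z⁻¹ * ψ (-1 * t * 4⁻¹ * z⁻¹) =
      gaussSum (complexQuadraticChar (ZMod q)) (ψ.mulShift (-1 * t * 4⁻¹)) :=
    Equiv.sum_comp (Equiv.inv (ZMod q))
      (fun z => complexQuadraticChar (ZMod q) z * ψ (-1 * t * 4⁻¹ * z))
  rw [hsum, gaussSum_complexQuadraticChar_mulShift hq2, map_mul, map_mul, h4]
  ring

theorem exists_sign_isotropicSum {ψ : AddChar (ZMod q) ℂ} (hψ : ψ.IsPrimitive) (hq : Odd q)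
    {k : ℕ} (hF : Fintype.card F = q ^ (2 * k + 1)) :
    ∃ ε : ℤ, ε ^ 2 = 1 ∧ ∀ α : F, isotropicSum q ψ α =
      (((if α = 0 then (q : ℤ) ^ (2 * k) else 0) +
        ε * q ^ k * quadraticChar (ZMod q) (Algebra.trace (ZMod q) F (α ^ 2)) : ℤ) : ℂ) := by
  have hq2 : ringChar (ZMod q) ≠ 2 := by
    rw [ZMod.ringChar_zmod_n]
    rintro rfl
    exact absurd hq (by decide)
  have hF2 : ringChar F ≠ 2 := by
    rwa [← Algebra.ringChar_eq (ZMod q) F]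
  have hΨ := traceChar_isPrimitive (F := F) hψ
  have hq0 : (q : ℂ) ≠ 0 := Nat.cast_ne_zero.2 (Fact.out : q.Prime).ne_zero
  have hm : Odd (2 * k + 1) := ⟨k, rfl⟩
  have h1 : complexQuadraticChar (ZMod q) (-1) ^ 2 = 1 := by
    have h := quadraticChar_sq_one (F := ZMod q) (neg_ne_zero.2 one_ne_zero)
    rw [complexQuadraticChar_apply, ← Int.cast_pow, h, Int.cast_one]
  have hneg : complexQuadraticChar F (-1) = complexQuadraticChar (ZMod q) (-1) := by
    rw [complexQuadraticChar_apply, complexQuadraticChar_apply,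
      ← quadraticChar_algebraMap_of_odd (F := F) hq2 hm (by rw [hF, ZMod.card]),
      map_neg (algebraMap (ZMod q) F), map_one (algebraMap (ZMod q) F)]
  have hG := gaussSum_complexQuadraticChar_sq hF2 hΨ
  have hg := gaussSum_complexQuadraticChar_sq hq2 hψ
  have hS := fun α => mul_isotropicSum hψ hq hm hF α
  set G := gaussSum (complexQuadraticChar F) (traceChar F ψ)
  set g := gaussSum (complexQuadraticChar (ZMod q)) ψ
  set c := complexQuadraticChar (ZMod q) (-1)
  have hK : (c * G * g) ^ 2 = ((q : ℂ) ^ (k + 1)) ^ 2 := by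
    rw [hneg, hF] at hG
    rw [ZMod.card] at hg
    rw [mul_pow, mul_pow, hG, hg, h1]
    push_cast
    linear_combination (q : ℂ) ^ (2 * k + 2) * h1
  have hε : ∃ ε : ℤ, ε ^ 2 = 1 ∧ c * G * g = ε * (q : ℂ) ^ (k + 1) := by
    rcases sq_eq_sq_iff_eq_or_eq_neg.1 hK with h | h
    · exact ⟨1, by norm_num, by rw [h]; simp⟩
    · exact ⟨-1, by norm_num, by rw [h]; simp⟩
  obtain ⟨ε, hε1, hε⟩ := hε
  refine ⟨ε, hε1, fun α => mul_left_cancel₀ hq0 ?_⟩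
  rw [hS, hε, complexQuadraticChar_apply]
  split_ifs <;> push_cast <;> ring

theorem mul_card_filter_trace_ne_zero {ψ : AddChar (ZMod q) ℂ} (hψ : ψ.IsPrimitive) {s : F → ℤ}
    (hs : ∀ α, isotropicSum q ψ α = s α)
    (hsmul : ∀ (z : ZMod q) (α : F), z ≠ 0 → s (z • α) = s α) (α β : F) :
    (q : ℤ) * ((defSet q F).filter
        (fun p => Algebra.trace (ZMod q) F (α * p.1 + β * p.2) ≠ 0)).card =
      (q - 1) * (s 0 ^ 2 - s α * s β) := by
  set A := univ.filter fun a : F => Algebra.trace (ZMod q) F (a ^ 2) = 0 with hA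
  have hD : (defSet q F).filter (fun p => Algebra.trace (ZMod q) F (α * p.1 + β * p.2) ≠ 0) =
      (A ×ˢ A).filter (fun p => Algebra.trace (ZMod q) F (α * p.1 + β * p.2) ≠ 0) := by
    ext ⟨a, b⟩
    simp only [defSet, hA, Finset.mem_filter, Finset.mem_univ, true_and, Finset.mem_product]
    constructor
    · rintro ⟨⟨-, h⟩, h'⟩
      exact ⟨h, h'⟩
    · rintro ⟨h, h'⟩
      refine ⟨⟨?_, h⟩, h'⟩
      rintro h0
      obtain ⟨rfl, rfl⟩ := Prod.mk.inj h0
      simp at h'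
  have hscale : ∀ z : ZMod q, ∑ p ∈ A ×ˢ A,
      ψ (z * Algebra.trace (ZMod q) F (α * p.1 + β * p.2)) =
      s α * s β + if z = 0 then ((s 0 : ℂ) ^ 2 - s α * s β) else 0 := by
    intro z
    have h := isotropicSum_mul_isotropicSum ψ (z • α) (z • β)
    simp only [smul_mul_assoc, ← smul_add, map_smul, smul_eq_mul] at h
    rw [← h, hs, hs]
    split_ifs with hz
    · rw [hz, zero_smul, zero_smul]; ring
    · rw [hsmul z α hz, hsmul z β hz, add_zero]
  have hcard : ((A ×ˢ A).card : ℂ) = (s 0 : ℂ) ^ 2 := by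
    have h := isotropicSum_mul_isotropicSum ψ (0 : F) 0
    simp only [zero_mul, add_zero, map_zero, AddChar.map_zero_eq_one, Finset.sum_const,
      nsmul_eq_mul, mul_one, hs] at h
    rw [sq, h]
  have hmain : (q : ℂ) * ((A ×ˢ A).filter
      (fun p => Algebra.trace (ZMod q) F (α * p.1 + β * p.2) ≠ 0)).card =
      (q - 1) * ((s 0 : ℂ) ^ 2 - s α * s β) := by
    calc _ = ∑ p ∈ A ×ˢ A, ((q : ℂ) -
          ∑ z : ZMod q, ψ (z * Algebra.trace (ZMod q) F (α * p.1 + β * p.2))) := by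
          rw [Finset.card_filter, Nat.cast_sum, Finset.mul_sum]
          refine Finset.sum_congr rfl fun p _ => ?_
          rw [AddChar.sum_mulShift _ hψ, ZMod.card]
          split_ifs <;> simp_all
      _ = _ := by
          rw [Finset.sum_sub_distrib, Finset.sum_comm, Finset.sum_const, nsmul_eq_mul, hcard,
            Finset.sum_congr rfl fun z _ => hscale z, Finset.sum_add_distrib,
            Finset.sum_ite_eq' univ (0 : ZMod q), if_pos (Finset.mem_univ _), Finset.sum_const,
            Finset.card_univ, ZMod.card, nsmul_eq_mul]
          ring
  rw [hD]
  exact_mod_cast hmain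

theorem sum_isotropicSum {ψ : AddChar (ZMod q) ℂ} (hψ : ψ.IsPrimitive) :
    ∑ α : F, isotropicSum q ψ α = Fintype.card F := by
  simp only [isotropicSum, ← traceChar_apply]
  rw [Finset.sum_comm, Finset.sum_congr rfl fun a _ =>
    AddChar.sum_mulShift a (traceChar_isPrimitive (F := F) hψ)]
  simp [Finset.sum_ite_eq']

theorem mul_leeW {ψ : AddChar (ZMod q) ℂ} (hψ : ψ.IsPrimitive) {s : F → ℤ}
    (hs : ∀ α, isotropicSum q ψ α = s α)
    (hsmul : ∀ (z : ZMod q) (α : F), z ≠ 0 → s (z • α) = s α) (α β : F) :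
    (q : ℤ) * leeW q F α β = 2 * ((q - 1) * (s 0 ^ 2 - s α * s β)) := by
  rw [leeW, Nat.cast_add, mul_add, mul_card_filter_trace_ne_zero hψ hs hsmul,
    mul_card_filter_trace_ne_zero hψ hs hsmul]
  ring

end TraceForm

theorem two_mul_card_filter_mul_eq_one {ι : Type*} [Fintype ι] (h : ι → ℤ)
    (hh : ∀ i, h i = 0 ∨ h i = 1 ∨ h i = -1) :
    2 * ((univ.filter fun p : ι × ι => h p.1 * h p.2 = 1).card : ℤ) =
      (∑ i, h i ^ 2) ^ 2 + (∑ i, h i) ^ 2 := by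
  rw [Finset.card_filter, Nat.cast_sum, Finset.mul_sum, sq, sq (∑ i, h i), Finset.sum_mul_sum,
    Finset.sum_mul_sum, ← Finset.sum_product', ← Finset.sum_product', ← Finset.sum_add_distrib]
  refine Finset.sum_congr rfl fun p _ => ?_
  rcases hh p.1 with h1 | h1 | h1 <;> rcases hh p.2 with h2 | h2 | h2 <;> simp [h1, h2]

theorem stmt11 (q m : ℕ) [Fact q.Prime] (hq : Odd q) (hm : 3 ≤ m) (hmodd : Odd m)
    (F : Type*) [Field F] [Fintype F] [DecidableEq F] [Algebra (ZMod q) F]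
    (hF : Fintype.card F = q ^ m) :
    2 * ((Finset.univ.filter (fun p : F × F => (leeW q F p.1 p.2 : ℤ) =
        2 * ((q : ℤ) - 1) * ((q : ℤ) ^ (2 * m - 3) - (q : ℤ) ^ (m - 2)))).card : ℤ) =
      ((q : ℤ) - 1) ^ 2 * ((q : ℤ) ^ (2 * m - 2) + (q : ℤ) ^ (m - 1)) := by
  obtain ⟨k, rfl⟩ := hmodd
  have hk : 1 ≤ k := by omega
  have hqp : q.Prime := Fact.out
  have hq1 : (1 : ℤ) < q := by exact_mod_cast hqp.one_lt
  have hqk : (1 : ℤ) < (q : ℤ) ^ k := one_lt_pow₀ hq1 (by omega)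
  have hψ := ZMod.isPrimitive_stdAddChar q
  obtain ⟨ε, hε, hS⟩ := exists_sign_isotropicSum (F := F) hψ hq hF
  set h : F → ℤ := fun α => quadraticChar (ZMod q) (Algebra.trace (ZMod q) F (α ^ 2)) with hh
  set s : F → ℤ := fun α => (if α = 0 then (q : ℤ) ^ (2 * k) else 0) + ε * q ^ k * h α with hs
  have hh0 : h 0 = 0 := by simp [hh]
  have hdich : ∀ α, h α = 0 ∨ h α = 1 ∨ h α = -1 := fun α => quadraticChar_isQuadratic _ _
  have hs0 : s 0 = (q : ℤ) ^ (2 * k) := by simp [hs, hh0]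
  have hs1 : ∀ α, α ≠ 0 → s α = ε * q ^ k * h α := fun α hα => by simp [hs, hα]
  have hsmul : ∀ (z : ZMod q) (α : F), z ≠ 0 → s (z • α) = s α := by
    intro z α hz
    simp only [hs, hh, smul_eq_zero, hz, false_or]
    rw [smul_pow, map_smul, smul_eq_mul, map_mul, quadraticChar_sq_one' hz, one_mul]
  have hiff : ∀ α β : F, (leeW q F α β : ℤ) = 2 * ((q : ℤ) - 1) *
      ((q : ℤ) ^ (2 * (2 * k + 1) - 3) - (q : ℤ) ^ (2 * k + 1 - 2)) ↔ h α * h β = 1 := by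
    intro α β
    have hW := mul_leeW hψ (s := s) hS hsmul α β
    have e1 : (q : ℤ) * (q : ℤ) ^ (2 * (2 * k + 1) - 3) = (q : ℤ) ^ (2 * k) * q ^ (2 * k) := by
      rw [← pow_succ', ← pow_add]; congr 1; omega
    have e2 : (q : ℤ) * (q : ℤ) ^ (2 * k + 1 - 2) = (q : ℤ) ^ (2 * k) := by
      rw [← pow_succ']; congr 1; omega
    have e3 : (q : ℤ) ^ (2 * k) = (q : ℤ) ^ k * q ^ k := by rw [← pow_add]; congr 1; omega
    have hprod : s α * s β = (q : ℤ) ^ (2 * k) ↔ h α * h β = 1 := by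
      have hndvd : ∀ x : ℤ, ε * q ^ k * x ≠ 1 := fun x hx => by
        have hd : (q : ℤ) ^ k ∣ 1 := ⟨ε * x, by rw [← hx]; ring⟩
        exact absurd (Int.le_of_dvd one_pos hd) (not_le.2 hqk)
      have hne : (q : ℤ) ^ (2 * k) ≠ 0 := by positivity
      have hzero : ∀ γ, s γ ≠ 1 := by
        intro γ
        rcases eq_or_ne γ 0 with rfl | hγ
        · rw [hs0, e3]; nlinarith
        · rw [hs1 γ hγ]; exact hndvd _
      rcases eq_or_ne α 0 with rfl | hα
      · rw [hs0, hh0, zero_mul, mul_eq_left₀ hne]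
        simp [hzero β]
      rcases eq_or_ne β 0 with rfl | hβ
      · rw [hs0, hh0, mul_zero, mul_eq_right₀ hne]
        simp [hzero α]
      · rw [hs1 α hα, hs1 β hβ, show ε * q ^ k * h α * (ε * q ^ k * h β) =
          (q : ℤ) ^ (2 * k) * (h α * h β) by
            rw [e3]; linear_combination (q : ℤ) ^ k * q ^ k * (h α * h β) * hε,
          mul_eq_left₀ hne]
    rw [← hprod]
    have hq0 : (q : ℤ) ≠ 0 := by positivity
    have h2q : 2 * ((q : ℤ) - 1) ≠ 0 := by
      intro h0
      linarith
    rw [hs0] at hW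
    constructor
    · intro hEq
      rw [hEq] at hW
      refine mul_left_cancel₀ h2q ?_
      linear_combination (-2 * ((q : ℤ) - 1)) * e1 + 2 * ((q : ℤ) - 1) * e2 + hW
    · intro hEq
      refine mul_left_cancel₀ hq0 ?_
      rw [hW, hEq]
      linear_combination (-2 * ((q : ℤ) - 1)) * e1 + 2 * ((q : ℤ) - 1) * e2
  have hsum : ε * q ^ k * ∑ α, h α = (q : ℤ) ^ (2 * k) * (q - 1) := by
    have h1 : ((∑ α, s α : ℤ) : ℂ) = ((q ^ (2 * k + 1) : ℤ) : ℂ) := by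
      have h2 := sum_isotropicSum (F := F) hψ
      rw [Finset.sum_congr rfl fun α _ => hS α, hF] at h2
      rw [Int.cast_sum, h2]
      push_cast; rfl
    have h3 : ∑ α, s α = (q : ℤ) ^ (2 * k) + ε * q ^ k * ∑ α, h α := by
      simp only [hs]
      rw [Finset.sum_add_distrib, ← Finset.mul_sum, Finset.sum_ite_eq' univ (0 : F),
        if_pos (Finset.mem_univ _)]
    have h4 := Int.cast_injective h1
    rw [h3] at h4
    linear_combination h4
  have hsq : ∑ α, h α ^ 2 = (q : ℤ) ^ (2 * k) * (q - 1) := by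
    have h0 : ((univ.filter fun a : F => Algebra.trace (ZMod q) F (a ^ 2) = 0).card : ℤ) =
        (q : ℤ) ^ (2 * k) := by
      have h1 : isotropicSum q ZMod.stdAddChar (0 : F) = (s 0 : ℂ) := hS 0
      rw [hs0] at h1
      simp only [isotropicSum, zero_mul, map_zero, AddChar.map_zero_eq_one, Finset.sum_const,
        nsmul_eq_mul, mul_one] at h1
      exact_mod_cast h1
    have h1 : ∀ α, h α ^ 2 = 1 - if Algebra.trace (ZMod q) F (α ^ 2) = 0 then 1 else 0 := by
      intro α
      split_ifs with h2
      · simp [hh, h2]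
      · simpa [hh] using quadraticChar_sq_one h2
    rw [Finset.sum_congr rfl fun α _ => h1 α, Finset.sum_sub_distrib, Finset.sum_boole, h0,
      Finset.sum_const, Finset.card_univ, hF, nsmul_eq_mul]
    push_cast; ring
  have hsum2 : (∑ α, h α) ^ 2 = (q : ℤ) ^ (2 * k) * (q - 1) ^ 2 := by
    have h0 : ((q : ℤ) ^ (2 * k)) ≠ 0 := by positivity
    refine mul_left_cancel₀ h0 ?_
    have h1 := congrArg (· ^ 2) hsum
    simp only [mul_pow, hε] at h1
    linear_combination h1
  simp only [hiff]
  rw [two_mul_card_filter_mul_eq_one h hdich, hsum2, hsq,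
    show 2 * (2 * k + 1) - 2 = 2 * k + 2 * k by omega, show 2 * k + 1 - 1 = 2 * k by omega]
  ring
end
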